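/- arXiv:1607.03081 — 2 statements merged into one kernel-verified Lean document; each statement's English description precedes it below -/
import Mathlib

section
/- Assume f is γ-strongly convex with γ > 0 and let x_* be a minimizer of F. Let H be a symmetric positive definite matrix with H ⪯ M·I for some M > 0, let x ∈ ℝⁿ, let ε ≥ 0, let ξ ∈ ℝ, and let x⁺ ∈ ℝⁿ be an ε-minimizer of the subproblem at x, i.e. Q_H(x⁺, x) ≤ Q_H(p_H(x), x) + ε, which moreover satisfies F(x⁺) ≤ Q_H(x⁺, x) + ξ. Then, with t' = γ/(γ + M), F(x⁺) − F(x_*) ≤ (1 − t')(F(x) − F(x_*)) + ε + ξ. -/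
open scoped RealInnerProductSpace
open Finset

/-- Matrix-vector product, viewed as an operation on Euclidean space. -/
noncomputable def mulVecE {n : ℕ} (H : Matrix (Fin n) (Fin n) ℝ)
    (w : EuclideanSpace ℝ (Fin n)) : EuclideanSpace ℝ (Fin n) :=
  (WithLp.equiv 2 (Fin n → ℝ)).symm (H.mulVec ((WithLp.equiv 2 (Fin n → ℝ)) w))

/-- The composite quadratic approximation
`Q_H(u,v) = f(v) + ⟨∇f(v), u−v⟩ + (1/2)⟨H(u−v), u−v⟩ + g(u)`. -/
noncomputable def Qa {n : ℕ} (f g : EuclideanSpace ℝ (Fin n) → ℝ)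
    (H : Matrix (Fin n) (Fin n) ℝ) (u v : EuclideanSpace ℝ (Fin n)) : ℝ :=
  f v + ⟪ gradient f v, u - v ⟫ + (1 / 2) * ⟪ mulVecE H (u - v), u - v ⟫ + g u

/-- A differentiable function with `γ`-strongly monotone gradient lies above its tangent planes
by at least `(γ / 2) ‖y - x‖²`. -/
theorem add_inner_gradient_add_sq_le {E : Type*} [NormedAddCommGroup E] [InnerProductSpace ℝ E]
    [CompleteSpace E] {f : E → ℝ} (hfd : Differentiable ℝ f) {γ : ℝ}
    (hsc : ∀ x y, γ * ‖x - y‖ ^ 2 ≤ ⟪gradient f x - gradient f y, x - y⟫) (x d : E) :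
    f x + ⟪gradient f x, d⟫ + γ / 2 * ‖d‖ ^ 2 ≤ f (x + d) := by
  have hderiv : ∀ s : ℝ, HasDerivAt
      (fun s : ℝ => f (x + s • d) - s * ⟪gradient f x, d⟫ - γ / 2 * ‖d‖ ^ 2 * s ^ 2)
      (⟪gradient f (x + s • d), d⟫ - ⟪gradient f x, d⟫ - γ * ‖d‖ ^ 2 * s) s := by
    intro s
    have hline : HasDerivAt (fun s : ℝ => x + s • d) d s := by
      simpa using ((hasDerivAt_id s).smul_const d).const_add x
    have hcomp := (hfd (x + s • d)).hasGradientAt.hasFDerivAt.comp_hasDerivAt s hline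
    rw [InnerProductSpace.toDual_apply_apply] at hcomp
    refine ((hcomp.sub ((hasDerivAt_id s).mul_const ⟪gradient f x, d⟫)).sub
      ((hasDerivAt_pow 2 s).const_mul (γ / 2 * ‖d‖ ^ 2))).congr_deriv ?_
    push_cast
    ring
  have hmono : MonotoneOn
      (fun s : ℝ => f (x + s • d) - s * ⟪gradient f x, d⟫ - γ / 2 * ‖d‖ ^ 2 * s ^ 2)
      (Set.Icc 0 1) := by
    refine monotoneOn_of_deriv_nonneg (convex_Icc 0 1)
      (fun s _ => (hderiv s).continuousAt.continuousWithinAt)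
      (fun s _ => (hderiv s).differentiableAt.differentiableWithinAt) fun s hs => ?_
    rw [interior_Icc] at hs
    rw [(hderiv s).deriv]
    have h := hsc (x + s • d) x
    rw [add_sub_cancel_left, inner_smul_right, norm_smul, inner_sub_left, mul_pow,
      Real.norm_eq_abs, sq_abs] at h
    refine nonneg_of_mul_nonneg_right (a := s) ?_ hs.1
    linarith
  have h := hmono (Set.left_mem_Icc.2 zero_le_one) (Set.right_mem_Icc.2 zero_le_one) zero_le_one
  simp only [zero_smul, one_smul, add_zero] at h
  linarith

theorem inner_mulVecE_self_le {n : ℕ} {H : Matrix (Fin n) (Fin n) ℝ} {M : ℝ}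
    (hHM : ((M • (1 : Matrix (Fin n) (Fin n) ℝ)) - H).PosSemidef)
    (w : EuclideanSpace ℝ (Fin n)) : ⟪mulVecE H w, w⟫ ≤ M * ‖w‖ ^ 2 := by
  have h := hHM.dotProduct_mulVec_nonneg (WithLp.ofLp w)
  rw [Matrix.sub_mulVec, Matrix.smul_mulVec, Matrix.one_mulVec, dotProduct_sub,
    dotProduct_smul, smul_eq_mul, star_trivial] at h
  have hsq : ‖w‖ ^ 2 = WithLp.ofLp w ⬝ᵥ WithLp.ofLp w := by
    rw [← real_inner_self_eq_norm_sq, EuclideanSpace.inner_eq_star_dotProduct, star_trivial]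
  have hinner : ⟪mulVecE H w, w⟫ = WithLp.ofLp w ⬝ᵥ H.mulVec (WithLp.ofLp w) := by
    rw [EuclideanSpace.inner_eq_star_dotProduct, star_trivial]
    rfl
  rw [hsq, hinner]
  linarith

theorem mulVecE_smul {n : ℕ} (H : Matrix (Fin n) (Fin n) ℝ) (t : ℝ)
    (w : EuclideanSpace ℝ (Fin n)) : mulVecE H (t • w) = t • mulVecE H w := by
  ext i
  simp [mulVecE, Matrix.mulVec_smul]

theorem stmt6 {n : ℕ} (f g : EuclideanSpace ℝ (Fin n) → ℝ)
    (hf : ConvexOn ℝ Set.univ f) (hfd : Differentiable ℝ f)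
    (L : ℝ) (hL : 0 < L)
    (hflip : ∀ x y, ‖gradient f x - gradient f y‖ ≤ L * ‖x - y‖)
    (hg : ConvexOn ℝ Set.univ g) (hgc : Continuous g)
    (γ : ℝ) (hγ : 0 < γ)
    (hsc : ∀ x y, γ * ‖x - y‖ ^ 2 ≤ ⟪ gradient f x - gradient f y, x - y ⟫)
    (xs : EuclideanSpace ℝ (Fin n)) (hxs : ∀ z, f xs + g xs ≤ f z + g z)
    (H : Matrix (Fin n) (Fin n) ℝ) (hH : H.PosDef)
    (M : ℝ) (hM : 0 < M)
    (hHM : ((M • (1 : Matrix (Fin n) (Fin n) ℝ)) - H).PosSemidef)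
    (x : EuclideanSpace ℝ (Fin n))
    (pH : EuclideanSpace ℝ (Fin n)) (hpH : ∀ u, Qa f g H pH x ≤ Qa f g H u x)
    (ε : ℝ) (hε : 0 ≤ ε) (ξ : ℝ)
    (xp : EuclideanSpace ℝ (Fin n))
    (hxp1 : Qa f g H xp x ≤ Qa f g H pH x + ε)
    (hxp2 : f xp + g xp ≤ Qa f g H xp x + ξ) :
    (f xp + g xp) - (f xs + g xs) ≤
      (1 - γ / (γ + M)) * ((f x + g x) - (f xs + g xs)) + ε + ξ := by
  set t := γ / (γ + M) with ht
  have hpos : 0 < γ + M := add_pos hγ hM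
  have ht0 : 0 ≤ t := (div_pos hγ hpos).le
  have ht1 : t ≤ 1 := (div_le_one hpos).2 (by linarith)
  have htM : t * M ≤ γ := by
    have : t * (γ + M) = γ := div_mul_cancel₀ γ hpos.ne'
    nlinarith
  have hstep := hpH (x + t • (xs - x))
  have hfs := add_inner_gradient_add_sq_le hfd hsc x (xs - x)
  have hHs := inner_mulVecE_self_le hHM (xs - x)
  have hgs : g (x + t • (xs - x)) ≤ (1 - t) * g x + t * g xs := by
    have h := hg.2 (Set.mem_univ x) (Set.mem_univ xs) (sub_nonneg.2 ht1) ht0 (by ring)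
    rw [smul_eq_mul, smul_eq_mul] at h
    rwa [show x + t • (xs - x) = (1 - t) • x + t • xs by module]
  rw [add_sub_cancel] at hfs
  have hQ : Qa f g H (x + t • (xs - x)) x = f x + t * ⟪gradient f x, xs - x⟫ +
      1 / 2 * (t * (t * ⟪mulVecE H (xs - x), xs - x⟫)) + g (x + t • (xs - x)) := by
    rw [Qa, add_sub_cancel_left, mulVecE_smul, real_inner_smul_left, real_inner_smul_right,
      real_inner_smul_right]
  have hf' := mul_le_mul_of_nonneg_left hfs ht0
  have hH' := mul_le_mul_of_nonneg_left hHs (mul_nonneg ht0 ht0)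
  have hquad := mul_le_mul_of_nonneg_right htM (mul_nonneg ht0 (sq_nonneg ‖xs - x‖))
  nlinarith
end

section
/- Let x_* be a minimizer of F. Let x_{k−1}, x_k ∈ ℝⁿ, let t_k ≥ 1 and t_{k+1} ≥ 1, let σ_k, σ_{k+1} > 0, and let H_k, H_{k+1} be symmetric positive definite matrices satisfying σ_{k+1} H_{k+1} ⪯ σ_k H_k and σ_k t_k² ≥ σ_{k+1} t_{k+1}(t_{k+1} − 1). Define y_{k+1} = x_k + ((t_k − 1)/t_{k+1})(x_k − x_{k−1}) and x_{k+1} = p_{H_{k+1}}(y_{k+1}), and assume F(x_{k+1}) ≤ Q_{H_{k+1}}(x_{k+1}, y_{k+1}). Setting v_j = F(x_j) − F(x_*) and u_j = t_j x_j − (t_j − 1) x_{j−1} − x_* for j ∈ {k, k+1}, one has 2 σ_k t_k² v_k + ‖u_k‖²_{σ_k H_k} ≥ 2 σ_{k+1} t_{k+1}² v_{k+1} + ‖u_{k+1}‖²_{σ_{k+1} H_{k+1}}. -/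
open scoped RealInnerProductSpace
open Finset

/-- First-order characterization of convexity: a differentiable convex function lies above its
tangent planes. -/
theorem ConvexOn.add_inner_gradient_le {E : Type*} [NormedAddCommGroup E] [InnerProductSpace ℝ E]
    [CompleteSpace E] {f : E → ℝ} (hf : ConvexOn ℝ Set.univ f) {v : E}
    (hfd : DifferentiableAt ℝ f v) (u : E) : f v + ⟪gradient f v, u - v⟫ ≤ f u := by
  have hc : ConvexOn ℝ Set.univ (f ∘ (AffineMap.lineMap v u : ℝ →ᵃ[ℝ] E)) := by
    simpa using hf.comp_affineMap (AffineMap.lineMap v u)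
  have hd : HasDerivAt (f ∘ (AffineMap.lineMap v u : ℝ →ᵃ[ℝ] E)) ⟪gradient f v, u - v⟫ 0 := by
    have h1 : HasFDerivAt f (InnerProductSpace.toDual ℝ E (gradient f v))
        (AffineMap.lineMap v u (0 : ℝ)) := by
      simpa using hfd.hasGradientAt.hasFDerivAt
    simpa using h1.comp_hasDerivAt (0 : ℝ) (AffineMap.hasDerivAt_lineMap (a := v) (b := u))
  have h := hc.le_slope_of_hasDerivAt (Set.mem_univ 0) (Set.mem_univ 1) zero_lt_one hd
  simp only [slope_def_field, Function.comp_apply, AffineMap.lineMap_apply_one,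
    AffineMap.lineMap_apply_zero] at h
  linarith

theorem mulVecE_add_vec {n : ℕ} (H : Matrix (Fin n) (Fin n) ℝ) (a b : EuclideanSpace ℝ (Fin n)) :
    mulVecE H (a + b) = mulVecE H a + mulVecE H b := by
  ext i
  simp [mulVecE, Matrix.mulVec_add]

theorem mulVecE_smul_vec {n : ℕ} (H : Matrix (Fin n) (Fin n) ℝ) (c : ℝ)
    (a : EuclideanSpace ℝ (Fin n)) : mulVecE H (c • a) = c • mulVecE H a := by
  ext i
  simp [mulVecE, Matrix.mulVec_smul]

theorem mulVecE_smul_matrix {n : ℕ} (c : ℝ) (H : Matrix (Fin n) (Fin n) ℝ)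
    (a : EuclideanSpace ℝ (Fin n)) : mulVecE (c • H) a = c • mulVecE H a := by
  ext i
  simp [mulVecE, Matrix.smul_mulVec]

theorem mulVecE_sub_matrix {n : ℕ} (H K : Matrix (Fin n) (Fin n) ℝ)
    (a : EuclideanSpace ℝ (Fin n)) : mulVecE (H - K) a = mulVecE H a - mulVecE K a := by
  ext i
  simp [mulVecE, Matrix.sub_mulVec]

theorem inner_mulVecE_smul_self {n : ℕ} (H : Matrix (Fin n) (Fin n) ℝ) (c : ℝ)
    (a : EuclideanSpace ℝ (Fin n)) :
    ⟪mulVecE H (c • a), c • a⟫ = c ^ 2 * ⟪mulVecE H a, a⟫ := by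
  rw [mulVecE_smul_vec, real_inner_smul_left, real_inner_smul_right]
  ring

theorem inner_mulVecE_self_nonneg {n : ℕ} {H : Matrix (Fin n) (Fin n) ℝ} (hH : H.PosSemidef)
    (a : EuclideanSpace ℝ (Fin n)) : 0 ≤ ⟪mulVecE H a, a⟫ := by
  have h := hH.dotProduct_mulVec_nonneg (WithLp.ofLp a)
  simpa [mulVecE, EuclideanSpace.inner_eq_star_dotProduct] using h

/-- The quadratic form of a matrix along a segment. -/
theorem inner_mulVecE_segment {n : ℕ} (H : Matrix (Fin n) (Fin n) ℝ) (s : ℝ)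
    (a b : EuclideanSpace ℝ (Fin n)) :
    ⟪mulVecE H ((1 - s) • a + s • b), (1 - s) • a + s • b⟫ =
      (1 - s) * ⟪mulVecE H a, a⟫ + s * ⟪mulVecE H b, b⟫
        - s * (1 - s) * ⟪mulVecE H (b - a), b - a⟫ := by
  have hba : b - a = b + (-1 : ℝ) • a := by module
  rw [hba]
  simp only [mulVecE_add_vec, mulVecE_smul_vec, inner_add_left, inner_add_right,
    real_inner_smul_left, real_inner_smul_right]
  ring

/-- Strong convexity of `u ↦ Q_H(u,v)` along segments, relative to the quadratic form of `H`. -/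
theorem Qa_segment_le {n : ℕ} (f : EuclideanSpace ℝ (Fin n) → ℝ)
    {g : EuclideanSpace ℝ (Fin n) → ℝ} (hg : ConvexOn ℝ Set.univ g)
    (H : Matrix (Fin n) (Fin n) ℝ) (v p u : EuclideanSpace ℝ (Fin n)) {s : ℝ}
    (hs0 : 0 ≤ s) (hs1 : s ≤ 1) :
    Qa f g H ((1 - s) • p + s • u) v ≤ (1 - s) * Qa f g H p v + s * Qa f g H u v
      - s * (1 - s) / 2 * ⟪mulVecE H (u - p), u - p⟫ := by
  have hgs := hg.2 (Set.mem_univ p) (Set.mem_univ u) (sub_nonneg.2 hs1) hs0 (by ring)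
  have hw : (1 - s) • p + s • u - v = (1 - s) • (p - v) + s • (u - v) := by module
  have hup : u - p = (u - v) - (p - v) := by abel
  simp only [Qa, smul_eq_mul] at hgs ⊢
  rw [hw, inner_mulVecE_segment, hup, inner_add_right, real_inner_smul_right,
    real_inner_smul_right]
  linarith

/-- A minimizer `p` of `Q_H(·,v)` satisfies the quadratic growth inequality. -/
theorem Qa_add_le_of_isMin {n : ℕ} {f g : EuclideanSpace ℝ (Fin n) → ℝ}
    (hg : ConvexOn ℝ Set.univ g) {H : Matrix (Fin n) (Fin n) ℝ}
    {v p : EuclideanSpace ℝ (Fin n)} (hp : ∀ u, Qa f g H p v ≤ Qa f g H u v)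
    (u : EuclideanSpace ℝ (Fin n)) :
    Qa f g H p v + 1 / 2 * ⟪mulVecE H (u - p), u - p⟫ ≤ Qa f g H u v := by
  have key : ∀ s ∈ Set.Ioo (0 : ℝ) 1,
      Qa f g H p v + (1 - s) / 2 * ⟪mulVecE H (u - p), u - p⟫ ≤ Qa f g H u v := by
    intro s hs
    have h := (hp _).trans (Qa_segment_le f hg H v p u hs.1.le hs.2.le)
    refine le_of_mul_le_mul_left ?_ hs.1
    linarith
  have hlim : Filter.Tendsto
      (fun s : ℝ => Qa f g H p v + (1 - s) / 2 * ⟪mulVecE H (u - p), u - p⟫)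
      (nhdsWithin 0 (Set.Ioi 0))
      (nhds (Qa f g H p v + (1 - 0) / 2 * ⟪mulVecE H (u - p), u - p⟫)) :=
    (Continuous.tendsto (by fun_prop) 0).mono_left nhdsWithin_le_nhds
  rw [sub_zero] at hlim
  exact le_of_tendsto hlim
    (Filter.eventually_of_mem (Ioo_mem_nhdsGT zero_lt_one) key)

theorem stmt12 {n : ℕ} (f g : EuclideanSpace ℝ (Fin n) → ℝ)
    (hf : ConvexOn ℝ Set.univ f) (hfd : Differentiable ℝ f)
    (L : ℝ) (hL : 0 < L)
    (hflip : ∀ x y, ‖gradient f x - gradient f y‖ ≤ L * ‖x - y‖)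
    (hg : ConvexOn ℝ Set.univ g) (hgc : Continuous g)
    (xs : EuclideanSpace ℝ (Fin n)) (hxs : ∀ z, f xs + g xs ≤ f z + g z)
    (xkm xk : EuclideanSpace ℝ (Fin n))
    (tk tk1 : ℝ) (htk : 1 ≤ tk) (htk1 : 1 ≤ tk1)
    (σk σk1 : ℝ) (hσk : 0 < σk) (hσk1 : 0 < σk1)
    (Hk Hk1 : Matrix (Fin n) (Fin n) ℝ) (hHk : Hk.PosDef) (hHk1 : Hk1.PosDef)
    (hLoew : (σk • Hk - σk1 • Hk1).PosSemidef)
    (htineq : σk1 * tk1 * (tk1 - 1) ≤ σk * tk ^ 2)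
    (yk1 : EuclideanSpace ℝ (Fin n))
    (hyk1 : yk1 = xk + ((tk - 1) / tk1) • (xk - xkm))
    (xk1 : EuclideanSpace ℝ (Fin n))
    (hxk1 : ∀ u, Qa f g Hk1 xk1 yk1 ≤ Qa f g Hk1 u yk1)
    (hdec : f xk1 + g xk1 ≤ Qa f g Hk1 xk1 yk1) :
    2 * σk1 * tk1 ^ 2 * ((f xk1 + g xk1) - (f xs + g xs)) +
        ⟪ mulVecE (σk1 • Hk1) (tk1 • xk1 - (tk1 - 1) • xk - xs),
          tk1 • xk1 - (tk1 - 1) • xk - xs ⟫ ≤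
      2 * σk * tk ^ 2 * ((f xk + g xk) - (f xs + g xs)) +
        ⟪ mulVecE (σk • Hk) (tk • xk - (tk - 1) • xkm - xs),
          tk • xk - (tk - 1) • xkm - xs ⟫ := by
  have ht : 0 < tk1 := by linarith
  set B : EuclideanSpace ℝ (Fin n) → ℝ := fun w => ⟪mulVecE Hk1 w, w⟫
  set z := (1 - 1 / tk1) • xk + (1 / tk1) • xs with hz
  set uk := tk • xk - (tk - 1) • xkm - xs with huk
  set uk1 := tk1 • xk1 - (tk1 - 1) • xk - xs with huk1
  have hinv : 1 / tk1 ≤ 1 := (div_le_one ht).2 htk1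
  have hzy : z - yk1 = (-(1 / tk1)) • uk := by
    rw [hz, hyk1, huk]
    match_scalars <;> field_simp <;> ring
  have hzx : z - xk1 = (-(1 / tk1)) • uk1 := by
    rw [hz, huk1]
    match_scalars <;> field_simp
  have hgrow := Qa_add_le_of_isMin hg hxk1 z
  have htangent := hf.add_inner_gradient_le (hfd yk1) z
  have hconv := (hf.add hg).2 (Set.mem_univ xk) (Set.mem_univ xs) (sub_nonneg.2 hinv)
    (one_div_nonneg.2 ht.le) (by ring)
  rw [← hz] at hconv
  simp only [Pi.add_apply, smul_eq_mul] at hconv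
  have hQz : Qa f g Hk1 z yk1 = f yk1 + ⟪gradient f yk1, z - yk1⟫
      + 1 / 2 * ((1 / tk1) ^ 2 * B uk) + g z := by
    rw [Qa, hzy, inner_mulVecE_smul_self, neg_sq]
  rw [hQz, hzx, inner_mulVecE_smul_self, neg_sq] at hgrow
  have hstep : f xk1 + g xk1 + 1 / 2 * ((1 / tk1) ^ 2 * B uk1) ≤
      (1 - 1 / tk1) * (f xk + g xk) + 1 / tk1 * (f xs + g xs)
        + 1 / 2 * ((1 / tk1) ^ 2 * B uk) := by
    linarith
  have hscaled : 2 * σk1 * tk1 ^ 2 * ((f xk1 + g xk1) - (f xs + g xs)) + σk1 * B uk1 ≤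
      2 * (σk1 * tk1 * (tk1 - 1)) * ((f xk + g xk) - (f xs + g xs)) + σk1 * B uk := by
    have h := mul_le_mul_of_nonneg_left hstep (by positivity : 0 ≤ 2 * tk1 ^ 2)
    field_simp at h
    linarith [mul_le_mul_of_nonneg_left h hσk1.le]
  have hgap := mul_le_mul_of_nonneg_right htineq (sub_nonneg.2 (hxs xk))
  have hmetric := inner_mulVecE_self_nonneg hLoew uk
  rw [mulVecE_sub_matrix, inner_sub_left] at hmetric
  have hsmul : ∀ w, ⟪mulVecE (σk1 • Hk1) w, w⟫ = σk1 * B w := fun w => by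
    rw [mulVecE_smul_matrix, real_inner_smul_left]
  rw [hsmul] at hmetric ⊢
  linarith
end
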